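/- Let d ∈ ℤ_{≥1}, let a ∈ O_F^×, and let θ : Z → ℂ^× be a group homomorphism trivial on Z ∩ J_d. For c ∈ {1, a}, suppose Ψ_c : Z·𝒰·J_d → ℂ^× is a group homomorphism satisfying Ψ_c(z) = θ(z) for z ∈ Z, Ψ_c(u) = 1 for u ∈ 𝒰, and Ψ_c(j) = Ψ_{X_{c·ϖ^{−d}}}(j) for j ∈ J_d, and let S_d(X_{c·ϖ^{−d}}, θ) = { f : K → ℂ : f(hk) = Ψ_c(h)·f(k) for all h ∈ Z·𝒰·J_d, k ∈ K } with K acting by right translation. Then S_d(X_{ϖ^{−d}}, θ) and S_d(X_{a·ϖ^{−d}}, θ) are isomorphic as K-representations. -/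

import Mathlib

open Matrix

noncomputable section

/-- A 2×2 matrix over `E`. -/
abbrev Mat (E : Type) := Matrix (Fin 2) (Fin 2) E

/-- The context: `E/F` is the unramified quadratic extension of a finite extension `F` of
`ℚ_p` (`p` odd), encoded via the Galois involution `sig` (whose fixed field is `F`),
the valuation `nu` (normalized by `nu ϖ = 1` for a uniformizer `ϖ` of `F`),
a square root `sqeps` of a non-square unit `eps = sqeps^2` of `O_F`, the residue-field
cardinality `q` of `F`, and an additive character `psi'` of `F` trivial on `p_F` and
nontrivial on `O_F`. -/
structure USetting (E : Type) [Field E] where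
  sig : E →+* E
  nu : E → WithTop ℤ
  sqeps : E
  pi : E
  q : ℕ
  psi' : E → ℂ
  sig_invol : ∀ x, sig (sig x) = x
  sig_ne : ∃ x, sig x ≠ x
  nu_eq_top : ∀ x, nu x = ⊤ ↔ x = 0
  nu_mul : ∀ x y, nu (x * y) = nu x + nu y
  nu_add : ∀ x y, min (nu x) (nu y) ≤ nu (x + y)
  nu_sig : ∀ x, nu (sig x) = nu x
  nu_pi : nu pi = 1
  sig_pi : sig pi = pi
  sig_sqeps : sig sqeps = - sqeps
  nu_sqeps : nu sqeps = 0
  eps_not_square : ∀ y, sig y = y → y * y ≠ sqeps * sqeps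
  gen : ∀ x : E, ∃ a b, sig a = a ∧ sig b = b ∧ x = a + b * sqeps
  nu_two : nu 2 = 0
  charzero : ∀ n : ℕ, (n : E) = 0 → n = 0
  complete : ∀ f : ℕ → E, (∀ n : ℕ, ((n : ℤ) : WithTop ℤ) ≤ nu (f (n + 1) - f n)) →
    ∃ L, ∀ n : ℕ, ((n : ℤ) : WithTop ℤ) ≤ nu (L - f n)
  res_card : ∃ R : Finset E, R.card = q ∧ (∀ x ∈ R, sig x = x ∧ 0 ≤ nu x) ∧
    ∀ y : E, sig y = y → 0 ≤ nu y → ∃! x, x ∈ R ∧ 1 ≤ nu (y - x)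
  psi'_mul : ∀ x y, sig x = x → sig y = y → psi' (x + y) = psi' x * psi' y
  psi'_ne : ∀ x, sig x = x → psi' x ≠ 0
  psi'_triv : ∀ x, sig x = x → 1 ≤ nu x → psi' x = 1
  psi'_nontriv : ∃ x, sig x = x ∧ 0 ≤ nu x ∧ psi' x ≠ 1

variable {E : Type} [Field E]

/-- The matrix `w₀ = [[0,1],[1,0]]`. -/
def w0 (E : Type) [Field E] : Mat E := !![0, 1; 1, 0]

/-- `G = U(1,1)(F)`. -/
def Gset (S : USetting E) : Set (Mat E) :=
  {g | (g.map ⇑S.sig)ᵀ * w0 E * g = w0 E}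

/-- `K = G ∩ GL₂(O_E)`: entries in `O_E` and determinant in `O_E^×`. -/
def Kset (S : USetting E) : Set (Mat E) :=
  {g | g ∈ Gset S ∧ (∀ i j, 0 ≤ S.nu (g i j)) ∧ S.nu g.det = 0}

/-- The congruence filtration subgroup `K_n` (for `n ≥ 1`; `K_0 = K` as a set). -/
def Kfil (S : USetting E) (n : ℤ) : Set (Mat E) :=
  {g | g ∈ Kset S ∧ ∀ i j, (n : WithTop ℤ) ≤ S.nu ((g - 1) i j)}

/-- `𝓑 = B ∩ K`, the upper triangular matrices in `K`. -/
def Bcal (S : USetting E) : Set (Mat E) := {g | g ∈ Kset S ∧ g 1 0 = 0}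

/-- `E^1`, the norm-one elements of `E`. -/
def E1set (S : USetting E) : Set E := {x | x * S.sig x = 1}

/-- `O_F^×` as a subset of `E`. -/
def OFunits (S : USetting E) : Set E := {x | S.sig x = x ∧ S.nu x = 0}

/-- `O_E^×` as a subset of `E`. -/
def OEunits (S : USetting E) : Set E := {x | S.nu x = 0}

/-- A character of `E^×`, encoded as a function `E → ℂ` multiplicative and
nonvanishing on nonzero elements. -/
def IsChar (χ : E → ℂ) : Prop :=
  (∀ x y : E, x ≠ 0 → y ≠ 0 → χ (x * y) = χ x * χ y) ∧ ∀ x : E, x ≠ 0 → χ x ≠ 0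

/-- A group homomorphism `E^1 → ℂ^×`, encoded as a function `E → ℂ`. -/
def IsE1Hom (S : USetting E) (φ : E → ℂ) : Prop :=
  (∀ x ∈ E1set S, ∀ y ∈ E1set S, φ (x * y) = φ x * φ y) ∧ ∀ x ∈ E1set S, φ x ≠ 0

/-- A homomorphism into `ℂ^×` on a subset of matrices. -/
def IsHomOn (A : Set (Mat E)) (Ψ : Mat E → ℂ) : Prop :=
  (∀ x ∈ A, ∀ y ∈ A, Ψ (x * y) = Ψ x * Ψ y) ∧ ∀ x ∈ A, Ψ x ≠ 0

/-- `1 + p_E^n`. -/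
def onePE (S : USetting E) (n : ℤ) : Set E := {x | (n : WithTop ℤ) ≤ S.nu (x - 1)}

/-- `1 + p_F^n`. -/
def onePF (S : USetting E) (n : ℤ) : Set E :=
  {x | S.sig x = x ∧ (n : WithTop ℤ) ≤ S.nu (x - 1)}

/-- `χ` is trivial on a set. -/
def TrivOn (χ : E → ℂ) (s : Set E) : Prop := ∀ x ∈ s, χ x = 1

/-- `χ` has depth `r`: trivial on `1+p_E^{r+1}` and (if `r ≥ 1`) nontrivial on `1+p_E^r`. -/
def HasDepth (S : USetting E) (χ : E → ℂ) (r : ℕ) : Prop :=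
  TrivOn χ (onePE S ((r : ℤ) + 1)) ∧ (r = 0 ∨ ¬ TrivOn χ (onePE S (r : ℤ)))

/-- `χ` has true depth `r`: the depth of its restriction to `F^×` is `r`. -/
def HasTrueDepth (S : USetting E) (χ : E → ℂ) (r : ℕ) : Prop :=
  TrivOn χ (onePF S ((r : ℤ) + 1)) ∧ (r = 0 ∨ ¬ TrivOn χ (onePF S (r : ℤ)))

/-- `χ` has minimal depth `r`: its depth and true depth both equal `r`. -/
def MinDepth (S : USetting E) (χ : E → ℂ) (r : ℕ) : Prop :=
  HasDepth S χ r ∧ HasTrueDepth S χ r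

/-- Right translation action on functions. -/
def rho (g : Mat E) : (Mat E → ℂ) →ₗ[ℂ] (Mat E → ℂ) where
  toFun f := fun k => f (k * g)
  map_add' _ _ := rfl
  map_smul' _ _ := rfl

/-- The space `V_χ^{K_n}`: functions on `K` (extended by zero off `K`) satisfying
`f(bk) = χ(b₁₁) f(k)` for `b ∈ 𝓑` and right `K_n`-invariance. -/
def Vsp (S : USetting E) (χ : E → ℂ) (n : ℤ) : Submodule ℂ (Mat E → ℂ) where
  carrier := {f | (∀ x, x ∉ Kset S → f x = 0) ∧
    (∀ b ∈ Bcal S, ∀ k ∈ Kset S, f (b * k) = χ (b 0 0) * f k) ∧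
    (∀ k ∈ Kset S, ∀ g ∈ Kfil S n, f (k * g) = f k)}
  add_mem' := by
    rintro f g ⟨hf0, hf1, hf2⟩ ⟨hg0, hg1, hg2⟩
    refine ⟨fun x hx => ?_, fun b hb k hk => ?_, fun k hk g' hg' => ?_⟩
    · simp [hf0 x hx, hg0 x hx]
    · simp only [Pi.add_apply, hf1 b hb k hk, hg1 b hb k hk]; ring
    · simp only [Pi.add_apply, hf2 k hk g' hg', hg2 k hk g' hg']
  zero_mem' := by
    refine ⟨fun x _ => rfl, fun b _ k _ => by simp, fun k _ g _ => rfl⟩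
  smul_mem' := by
    rintro c f ⟨hf0, hf1, hf2⟩
    refine ⟨fun x hx => ?_, fun b hb k hk => ?_, fun k hk g' hg' => ?_⟩
    · simp [hf0 x hx]
    · simp only [Pi.smul_apply, hf1 b hb k hk, smul_eq_mul]; ring
    · simp only [Pi.smul_apply, hf2 k hk g' hg']

/-- The space of the representation induced from a character `Ψ` of a subgroup `H ⊆ K`:
functions on `K` (extended by zero) with `f(hk) = Ψ(h) f(k)`. -/
def IndSp (S : USetting E) (H : Set (Mat E)) (Ψ : Mat E → ℂ) : Submodule ℂ (Mat E → ℂ) where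
  carrier := {f | (∀ x, x ∉ Kset S → f x = 0) ∧
    ∀ h ∈ H, ∀ k ∈ Kset S, f (h * k) = Ψ h * f k}
  add_mem' := by
    rintro f g ⟨hf0, hf1⟩ ⟨hg0, hg1⟩
    refine ⟨fun x hx => ?_, fun h hh k hk => ?_⟩
    · simp [hf0 x hx, hg0 x hx]
    · simp only [Pi.add_apply, hf1 h hh k hk, hg1 h hh k hk]; ring
  zero_mem' := ⟨fun x _ => rfl, fun h _ k _ => by simp⟩
  smul_mem' := by
    rintro c f ⟨hf0, hf1⟩
    refine ⟨fun x hx => ?_, fun h hh k hk => ?_⟩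
    · simp [hf0 x hx]
    · simp only [Pi.smul_apply, hf1 h hh k hk, smul_eq_mul]; ring

/-- The functions constant on `K` and zero off `K`. -/
def ConstSub (S : USetting E) : Submodule ℂ (Mat E → ℂ) where
  carrier := {f | (∀ x, x ∉ Kset S → f x = 0) ∧ ∃ c : ℂ, ∀ k ∈ Kset S, f k = c}
  add_mem' := by
    rintro f g ⟨hf0, c, hc⟩ ⟨hg0, c', hc'⟩
    exact ⟨fun x hx => by simp [hf0 x hx, hg0 x hx],
      c + c', fun k hk => by simp [hc k hk, hc' k hk]⟩
  zero_mem' := ⟨fun x _ => rfl, 0, fun _ _ => rfl⟩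
  smul_mem' := by
    rintro a f ⟨hf0, c, hc⟩
    exact ⟨fun x hx => by simp [hf0 x hx], a * c, fun k hk => by simp [hc k hk]⟩

/-- A subspace is `K`-invariant. -/
def KInvariant (S : USetting E) (W : Submodule ℂ (Mat E → ℂ)) : Prop :=
  ∀ g ∈ Kset S, ∀ f ∈ W, rho g f ∈ W

/-- A subset `A ⊆ K` acts trivially on `W`. -/
def ActsTrivially (S : USetting E) (A : Set (Mat E)) (W : Submodule ℂ (Mat E → ℂ)) : Prop :=
  ∀ g ∈ A, ∀ f ∈ W, rho g f = f

/-- `W` is an irreducible representation of `K`. -/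
def IsIrredRep (S : USetting E) (W : Submodule ℂ (Mat E → ℂ)) : Prop :=
  W ≠ ⊥ ∧ KInvariant S W ∧
    ∀ U : Submodule ℂ (Mat E → ℂ), U ≤ W → KInvariant S U → U = ⊥ ∨ U = W

/-- `V` and `W` are isomorphic as representations of `K`. -/
def RepIso (S : USetting E) (V W : Submodule ℂ (Mat E → ℂ)) : Prop :=
  ∃ e : (Mat E → ℂ) →ₗ[ℂ] (Mat E → ℂ), Set.BijOn ⇑e ↑V ↑W ∧
    ∀ g ∈ Kset S, ∀ f ∈ V, e (rho g f) = rho g (e f)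

/-- The space of `ℂ`-linear endomorphisms of `V` commuting with the right-translation
action of `K`, realized inside the function space `↥V → ↥V`. -/
def Commutant (S : USetting E) (V : Submodule ℂ (Mat E → ℂ)) :
    Submodule ℂ (↥V → ↥V) where
  carrier := {T | (∀ x y : ↥V, T (x + y) = T x + T y) ∧
    (∀ (c : ℂ) (x : ↥V), T (c • x) = c • T x) ∧
    ∀ g ∈ Kset S, ∀ f : ↥V, ∀ h : rho g (f : Mat E → ℂ) ∈ V,
      ((T ⟨rho g (f : Mat E → ℂ), h⟩ : ↥V) : Mat E → ℂ) = rho g ((T f : ↥V) : Mat E → ℂ)}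
  add_mem' := by
    rintro T T' ⟨hT1, hT2, hT3⟩ ⟨hT1', hT2', hT3'⟩
    refine ⟨fun x y => ?_, fun c x => ?_, fun g hg f h => ?_⟩
    · simp only [Pi.add_apply, hT1 x y, hT1' x y]; abel
    · simp only [Pi.add_apply, hT2 c x, hT2' c x, smul_add]
    · simp only [Pi.add_apply, Submodule.coe_add, hT3 g hg f h, hT3' g hg f h, map_add]
  zero_mem' := by
    refine ⟨fun x y => by simp, fun c x => by simp, fun g hg f h => by simp⟩
  smul_mem' := by
    rintro c T ⟨hT1, hT2, hT3⟩
    refine ⟨fun x y => ?_, fun a x => ?_, fun g hg f h => ?_⟩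
    · simp only [Pi.smul_apply, hT1 x y, smul_add]
    · simp only [Pi.smul_apply, hT2 a x, smul_comm c a]
    · simp only [Pi.smul_apply, Submodule.coe_smul, hT3 g hg f h, _root_.map_smul]

/-- The additive character `ψ` of `E`, `ψ(x) = ψ'((x + σ(x))/2)`. -/
def psiE (S : USetting E) (x : E) : ℂ := S.psi' ((x + S.sig x) / 2)

/-- `Ψ_Y(g) = ψ(Tr(Y (g − 1)))`. -/
def PsiC (S : USetting E) (Y g : Mat E) : ℂ := psiE S ((Y * (g - 1)).trace)

/-- The Lie algebra `𝔤 = 𝔲(1,1)(F)`. -/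
def gfrak (S : USetting E) : Set (Mat E) :=
  {Y | (Y.map ⇑S.sig)ᵀ * w0 E + w0 E * Y = 0}

/-- The lattice `𝔨_s` of the Lie algebra, where `c = ⌈s⌉`. -/
def kfrakC (S : USetting E) (c : ℤ) : Set (Mat E) :=
  {Y | Y ∈ gfrak S ∧ (c : WithTop ℤ) ≤ S.nu (Y 0 0) ∧ (c : WithTop ℤ) ≤ S.nu (Y 1 1) ∧
    (∃ t, S.sig t = t ∧ (c : WithTop ℤ) ≤ S.nu t ∧ Y 0 1 = S.sqeps * t) ∧
    (∃ t, S.sig t = t ∧ (c : WithTop ℤ) ≤ S.nu t ∧ Y 1 0 = S.sqeps * t)}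

/-- The group `J_d`. -/
def Jgrp (S : USetting E) (d : ℕ) : Set (Mat E) :=
  {g | g ∈ Kset S ∧ ((((d + 1) / 2 : ℕ) : WithTop ℤ) ≤ S.nu (g 0 0 - 1)) ∧
    ((((d + 1) / 2 : ℕ) : WithTop ℤ) ≤ S.nu (g 0 1)) ∧
    ((((d + 1) / 2 : ℕ) : WithTop ℤ) ≤ S.nu (g 1 1 - 1)) ∧
    (((d / 2 + 1 : ℕ) : WithTop ℤ) ≤ S.nu (g 1 0))}

/-- The centralizer `T(X)` in `K` of `X = [[z√ε, u√ε],[v√ε, z√ε]]`. -/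
def TXset (S : USetting E) (u v : E) : Set (Mat E) :=
  {m | m ∈ Kset S ∧ m 1 1 = m 0 0 ∧ m 1 0 = m 0 1 * (u⁻¹ * v)}

/-- The center `Z` of `G`, identified with scalar matrices with entries in `E^1`. -/
def Zset (S : USetting E) : Set (Mat E) := {m | ∃ z ∈ E1set S, m = z • (1 : Mat E)}

/-- `𝒰 = U ∩ K`. -/
def Uset (S : USetting E) : Set (Mat E) :=
  {m | ∃ b, S.sig b = b ∧ 0 ≤ S.nu b ∧ m = !![1, b * S.sqeps; 0, 1]}

/-- The set of products `T(X)·J_d`. -/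
def TXJ (S : USetting E) (u v : E) (d : ℕ) : Set (Mat E) :=
  {x | ∃ t ∈ TXset S u v, ∃ j ∈ Jgrp S d, x = t * j}

/-- The set of products `Z·𝒰·J_d`. -/
def ZUJ (S : USetting E) (d : ℕ) : Set (Mat E) :=
  {x | ∃ z ∈ Zset S, ∃ m ∈ Uset S, ∃ j ∈ Jgrp S d, x = z * m * j}

/-- `X = [[z√ε, u√ε],[v√ε, z√ε]]`. -/
def Xzuv (S : USetting E) (z u v : E) : Mat E :=
  !![z * S.sqeps, u * S.sqeps; v * S.sqeps, z * S.sqeps]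

/-- The nilpotent element `X_δ = [[0, δ√ε],[0,0]]`. -/
def Xdelta (S : USetting E) (δ : E) : Mat E := !![0, δ * S.sqeps; 0, 0]

/-- `W` is a `K`-invariant complement of `V_χ^{K_d}` inside `V_χ^{K_{d+1}}`. -/
def Wcompl (S : USetting E) (χ : E → ℂ) (d : ℕ) (W : Submodule ℂ (Mat E → ℂ)) : Prop :=
  W ≤ Vsp S χ ((d : ℤ) + 1) ∧ KInvariant S W ∧
    Vsp S χ (d : ℤ) ⊓ W = ⊥ ∧ Vsp S χ (d : ℤ) ⊔ W = Vsp S χ ((d : ℤ) + 1)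

namespace USetting

variable (S : USetting E)

lemma nu_one : S.nu 1 = 0 := by
  have h := S.nu_mul 1 1
  have ht : S.nu 1 ≠ ⊤ := fun h => one_ne_zero ((S.nu_eq_top 1).1 h)
  lift S.nu 1 to ℤ using ht with n hn
  rw [mul_one, ← hn] at h
  norm_cast at h ⊢
  omega

lemma nu_eq_zero_of_add_self {x : E} (h : S.nu x + S.nu x = 0) : S.nu x = 0 := by
  have ht : S.nu x ≠ ⊤ := by
    intro ht
    simp [ht] at h
  lift S.nu x to ℤ using ht with n
  norm_cast at h ⊢
  omega

lemma nu_neg (x : E) : S.nu (-x) = S.nu x := by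
  have h : S.nu (-1) = 0 := S.nu_eq_zero_of_add_self (by
    rw [← S.nu_mul, neg_one_mul, neg_neg, S.nu_one])
  rw [← neg_one_mul, S.nu_mul, h, zero_add]

lemma le_nu_add {n : WithTop ℤ} {x y : E} (hx : n ≤ S.nu x) (hy : n ≤ S.nu y) :
    n ≤ S.nu (x + y) :=
  (le_min hx hy).trans (S.nu_add x y)

lemma le_nu_sub {n : WithTop ℤ} {x y : E} (hx : n ≤ S.nu x) (hy : n ≤ S.nu y) :
    n ≤ S.nu (x - y) := by
  rw [sub_eq_add_neg]
  exact S.le_nu_add hx (by rwa [S.nu_neg])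

lemma nu_zero : S.nu 0 = ⊤ := (S.nu_eq_top 0).2 rfl

lemma ne_zero_of_nu_eq_zero {x : E} (h : S.nu x = 0) : x ≠ 0 := by
  rintro rfl
  simp [S.nu_zero] at h

lemma nu_inv {x : E} (h : S.nu x = 0) : S.nu x⁻¹ = 0 := by
  have := S.nu_mul x x⁻¹
  rwa [mul_inv_cancel₀ (S.ne_zero_of_nu_eq_zero h), S.nu_one, h, zero_add, eq_comm] at this

lemma nu_mul_nonneg {x y : E} (hx : 0 ≤ S.nu x) (hy : 0 ≤ S.nu y) : 0 ≤ S.nu (x * y) := by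
  rw [S.nu_mul]
  exact add_nonneg hx hy

lemma nu_eq_zero_of_not_one_le {x : E} (h0 : 0 ≤ S.nu x) (h1 : ¬ 1 ≤ S.nu x) :
    S.nu x = 0 := by
  have ht : S.nu x ≠ ⊤ := by
    intro ht
    simp [ht] at h1
  lift S.nu x to ℤ using ht with n
  norm_cast at h0 h1 ⊢
  omega

lemma nu_pi_zpow_neg (d : ℕ) : S.nu (S.pi ^ (-(d : ℤ))) = ((-(d : ℤ) : ℤ) : WithTop ℤ) := by
  have hpi : S.pi ≠ 0 := by
    intro h
    have := S.nu_pi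
    rw [h, S.nu_zero] at this
    exact absurd this (by decide)
  have hp : ∀ n : ℕ, S.nu (S.pi ^ n) = ((n : ℤ) : WithTop ℤ) := by
    intro n
    induction n with
    | zero => simpa using S.nu_one
    | succ n ih =>
      rw [pow_succ, S.nu_mul, ih, S.nu_pi]
      norm_cast
  have h := S.nu_mul (S.pi ^ (-(d : ℤ))) (S.pi ^ d)
  rw [_root_.zpow_neg, zpow_natCast, inv_mul_cancel₀ (pow_ne_zero _ hpi), S.nu_one, hp] at h
  rw [_root_.zpow_neg, zpow_natCast]
  have ht : S.nu (S.pi ^ d)⁻¹ ≠ ⊤ := by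
    intro ht
    rw [ht] at h
    simp at h
  lift S.nu (S.pi ^ d)⁻¹ to ℤ using ht with n
  norm_cast at h ⊢
  omega

/-- The ring of integers `O_F`. -/
def integers : Subring E where
  carrier := {x | S.sig x = x ∧ 0 ≤ S.nu x}
  mul_mem' := fun hx hy => ⟨by rw [map_mul, hx.1, hy.1], S.nu_mul_nonneg hx.2 hy.2⟩
  one_mem' := ⟨map_one _, S.nu_one.ge⟩
  add_mem' := fun hx hy => ⟨by rw [map_add, hx.1, hy.1], S.le_nu_add hx.2 hy.2⟩
  zero_mem' := ⟨map_zero _, by rw [S.nu_zero]; exact le_top⟩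
  neg_mem' := fun hx => ⟨by rw [map_neg, hx.1], by rw [S.nu_neg]; exact hx.2⟩

/-- The maximal ideal `p_F` of `O_F`. -/
def maximalIdeal : Ideal S.integers where
  carrier := {x | 1 ≤ S.nu (x : E)}
  add_mem' := fun hx hy => S.le_nu_add hx hy
  zero_mem' := by
    change 1 ≤ S.nu 0
    rw [S.nu_zero]
    exact le_top
  smul_mem' := fun c x hx => by
    change 1 ≤ S.nu ((c : E) * x)
    rw [S.nu_mul]
    exact (zero_add (1 : WithTop ℤ)).symm.le.trans (add_le_add c.2.2 hx)

lemma mem_maximalIdeal {x : S.integers} : x ∈ S.maximalIdeal ↔ 1 ≤ S.nu (x : E) := Iff.rfl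

lemma isMaximal_maximalIdeal : S.maximalIdeal.IsMaximal := by
  rw [Ideal.isMaximal_iff]
  refine ⟨?_, fun J x hJ hx hxJ => ?_⟩
  · rw [mem_maximalIdeal]
    change ¬ 1 ≤ S.nu 1
    rw [S.nu_one]
    decide
  · have h0 := S.nu_eq_zero_of_not_one_le x.2.2 hx
    have hy : (x : E)⁻¹ ∈ S.integers := ⟨by rw [map_inv₀, x.2.1], (S.nu_inv h0).ge⟩
    have h1 : (⟨_, hy⟩ : S.integers) * x = 1 :=
      Subtype.ext (inv_mul_cancel₀ (S.ne_zero_of_nu_eq_zero h0))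
    rw [← h1]
    exact J.mul_mem_left _ hxJ

lemma finite_residueField : Finite (S.integers ⧸ S.maximalIdeal) := by
  obtain ⟨R, -, hR, hR'⟩ := S.res_card
  refine Finite.of_surjective
    (fun x : R => Ideal.Quotient.mk S.maximalIdeal ⟨x.1, hR x.1 x.2⟩) fun y => ?_
  obtain ⟨y, rfl⟩ := Ideal.Quotient.mk_surjective y
  obtain ⟨x, ⟨hx, hxy⟩, -⟩ := hR' y y.2.1 y.2.2
  refine ⟨⟨x, hx⟩, (Ideal.Quotient.eq.2 ?_).symm⟩
  exact hxy

/-- Modulo `p_F`, every unit of `O_F` is a norm from `O_E`. -/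
lemma exists_norm_one_le {a : E} (haf : S.sig a = a) (hau : S.nu a = 0) :
    ∃ α, 1 ≤ S.nu (a - α * S.sig α) := by
  have := S.isMaximal_maximalIdeal
  have := S.finite_residueField
  let k := S.integers ⧸ S.maximalIdeal
  let : Field k := Ideal.Quotient.field _
  let : Fintype k := Fintype.ofFinite k
  have h2 : ringChar k ≠ 2 := by
    intro h
    have h0 : (2 : k) = 0 := by
      have := ringChar.Nat.cast_ringChar (R := k)
      rw [h] at this
      exact_mod_cast this
    have hm : (2 : S.integers) ∈ S.maximalIdeal := Ideal.Quotient.eq_zero_iff_mem.1 h0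
    rw [mem_maximalIdeal] at hm
    change 1 ≤ S.nu 2 at hm
    rw [S.nu_two] at hm
    exact absurd hm (by decide)
  have hodd : Fintype.card k % 2 = 1 := FiniteField.odd_card_of_char_ne_two h2
  have hεm : S.sqeps * S.sqeps ∈ S.integers :=
    ⟨by simp [S.sig_sqeps], by rw [S.nu_mul, S.nu_sqeps, add_zero]⟩
  let π : S.integers →+* k := Ideal.Quotient.mk S.maximalIdeal
  let ā : k := π ⟨a, haf, hau.ge⟩
  let ε : k := π ⟨_, hεm⟩
  have hε : -ε ≠ 0 := by
    rw [neg_ne_zero]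
    intro h
    have hm := Ideal.Quotient.eq_zero_iff_mem.1 h
    rw [mem_maximalIdeal] at hm
    change 1 ≤ S.nu (S.sqeps * S.sqeps) at hm
    rw [S.nu_mul, S.nu_sqeps, add_zero] at hm
    exact absurd hm (by decide)
  obtain ⟨x, y, hxy⟩ := FiniteField.exists_root_sum_quadratic
    (f := Polynomial.C (1 : k) * Polynomial.X ^ 2 + Polynomial.C 0 * Polynomial.X +
      Polynomial.C (-ā))
    (g := Polynomial.C (-ε) * Polynomial.X ^ 2 + Polynomial.C 0 * Polynomial.X + Polynomial.C 0)
    (Polynomial.degree_quadratic one_ne_zero) (Polynomial.degree_quadratic hε) hodd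
  obtain ⟨x, rfl⟩ := Ideal.Quotient.mk_surjective x
  obtain ⟨y, rfl⟩ := Ideal.Quotient.mk_surjective y
  refine ⟨x + y * S.sqeps, ?_⟩
  have hz : π (⟨a, haf, hau.ge⟩ - (x * x - ⟨_, hεm⟩ * (y * y))) = 0 := by
    simp only [Polynomial.eval_add, Polynomial.eval_mul, Polynomial.eval_C, Polynomial.eval_pow,
      Polynomial.eval_X] at hxy
    simp only [map_sub, map_mul]
    change ā - (π x * π x - ε * (π y * π y)) = 0
    linear_combination -hxy
  have hm := Ideal.Quotient.eq_zero_iff_mem.1 hz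
  rw [mem_maximalIdeal] at hm
  convert hm using 2
  rw [map_add, map_mul, x.2.1, y.2.1, S.sig_sqeps]
  push_cast
  ring

lemma nu_eq_zero_of_norm_approx {a α : E} (hau : S.nu a = 0) {n : ℕ} (hn : 1 ≤ n)
    (h : (n : WithTop ℤ) ≤ S.nu (a - α * S.sig α)) : S.nu α = 0 := by
  have h1 : (1 : WithTop ℤ) ≤ S.nu (a - α * S.sig α) := le_trans (by exact_mod_cast hn) h
  have hlt : ¬ 1 ≤ S.nu (α * S.sig α) := by
    intro hN
    have := S.le_nu_add h1 hN
    rw [sub_add_cancel, hau] at this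
    exact absurd this (by decide)
  have h0 : 0 ≤ S.nu (α * S.sig α) := by
    have := S.le_nu_sub hau.ge (le_trans (by decide) h1)
    rwa [sub_sub_cancel] at this
  have hN := S.nu_eq_zero_of_not_one_le h0 hlt
  rw [S.nu_mul, S.nu_sig] at hN
  exact S.nu_eq_zero_of_add_self hN

/-- Every unit of `O_F` is a norm from `O_E` modulo any power of `p_F`. -/
lemma exists_norm_approx {a : E} (haf : S.sig a = a) (hau : S.nu a = 0) (n : ℕ) (hn : 1 ≤ n) :
    ∃ α, (n : WithTop ℤ) ≤ S.nu (a - α * S.sig α) := by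
  induction n, hn using Nat.le_induction with
  | base => simpa using S.exists_norm_one_le haf hau
  | succ n hn ih =>
    obtain ⟨α, hα⟩ := ih
    have hN : S.nu (α * S.sig α) = 0 := by
      have h := S.nu_eq_zero_of_norm_approx hau hn hα
      rw [S.nu_mul, S.nu_sig, h, add_zero]
    have hN0 := S.ne_zero_of_nu_eq_zero hN
    have h2 := S.ne_zero_of_nu_eq_zero S.nu_two
    set N := α * S.sig α with hNdef
    have hsN : S.sig N = N := by rw [hNdef, map_mul, S.sig_invol, mul_comm]
    set c := 1 + (a - N) * (N⁻¹ * 2⁻¹) with hc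
    have hsc : S.sig c = c := by simp [hc, haf, hsN, map_ofNat S.sig 2]
    refine ⟨α * c, ?_⟩
    have : a - α * c * S.sig (α * c) =
        -((a - N) * (a - N) * (N⁻¹ * 2⁻¹ * 2⁻¹)) := by
      rw [map_mul, hsc, show α * c * (S.sig α * c) = N * c * c by rw [hNdef]; ring, hc]
      field_simp
      ring
    rw [this, S.nu_neg, S.nu_mul, S.nu_mul, S.nu_mul, S.nu_mul, S.nu_inv hN, S.nu_inv S.nu_two,
      add_zero, add_zero, add_zero]
    refine le_trans ?_ (add_le_add hα hα)
    norm_cast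
    omega

end USetting

lemma mul_mem_Kset (S : USetting E) {g h : Mat E} (hg : g ∈ Kset S) (hh : h ∈ Kset S) :
    g * h ∈ Kset S := by
  obtain ⟨hg1, hg2, hg3⟩ := hg
  obtain ⟨hh1, hh2, hh3⟩ := hh
  refine ⟨?_, fun i j => ?_, ?_⟩
  · change (g.map S.sig)ᵀ * w0 E * g = w0 E at hg1
    change (h.map S.sig)ᵀ * w0 E * h = w0 E at hh1
    change ((g * h).map S.sig)ᵀ * w0 E * (g * h) = w0 E
    rw [Matrix.map_mul, Matrix.transpose_mul]
    calc (h.map S.sig)ᵀ * (g.map S.sig)ᵀ * w0 E * (g * h)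
        = (h.map S.sig)ᵀ * ((g.map S.sig)ᵀ * w0 E * g) * h := by simp only [Matrix.mul_assoc]
      _ = w0 E := by rw [hg1, hh1]
  · rw [Matrix.mul_apply, Fin.sum_univ_two]
    exact S.le_nu_add (S.nu_mul_nonneg (hg2 _ _) (hh2 _ _)) (S.nu_mul_nonneg (hg2 _ _) (hh2 _ _))
  · rw [Matrix.det_mul, S.nu_mul, hg3, hh3, add_zero]

/-- Twisting the inducing character by an element of `K` normalizing the subgroup gives an
isomorphic induced representation. -/
lemma repIso_indSp_of_conj (S : USetting E) {H : Set (Mat E)} {Ψ Ψ' : Mat E → ℂ} {s t : Mat E}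
    (hs : s ∈ Kset S) (ht : t ∈ Kset S) (hst : s * t = 1) (hts : t * s = 1)
    (hH : ∀ h ∈ H, s * h * t ∈ H) (hH' : ∀ h ∈ H, t * h * s ∈ H)
    (hΨ : ∀ h ∈ H, Ψ (s * h * t) = Ψ' h) :
    RepIso S (IndSp S H Ψ) (IndSp S H Ψ') := by
  have cancel_st : ∀ k, s * (t * k) = k := fun k => by rw [← Matrix.mul_assoc, hst, Matrix.one_mul]
  have cancel_ts : ∀ k, t * (s * k) = k := fun k => by rw [← Matrix.mul_assoc, hts, Matrix.one_mul]
  let translate (m : Mat E) : (Mat E → ℂ) →ₗ[ℂ] (Mat E → ℂ) := LinearMap.funLeft ℂ ℂ (m * ·)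
  have htr : ∀ m f k, translate m f k = f (m * k) := fun _ _ _ => rfl
  refine ⟨translate s, Set.BijOn.mk ?_ ?_ ?_, ?_⟩
  · rintro f ⟨hf0, hf1⟩
    refine ⟨fun x hx => hf0 _ fun hsx => hx ?_, fun h hh k hk => ?_⟩
    · rw [← cancel_ts x]
      exact mul_mem_Kset S ht hsx
    · rw [htr, htr, ← hΨ h hh, ← hf1 _ (hH h hh) _ (mul_mem_Kset S hs hk)]
      simp only [Matrix.mul_assoc, cancel_ts]
  · intro f _ g _ hfg
    funext k
    have := congrFun hfg (t * k)
    rwa [htr, htr, cancel_st] at this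
  · rintro f ⟨hf0, hf1⟩
    refine ⟨translate t f, ⟨fun x hx => hf0 _ fun htx => hx ?_, fun h hh k hk => ?_⟩, ?_⟩
    · rw [← cancel_st x]
      exact mul_mem_Kset S hs htx
    · have h1 := hΨ _ (hH' h hh)
      simp only [Matrix.mul_assoc, cancel_st, hst, Matrix.mul_one] at h1
      rw [htr, htr, h1, ← Matrix.mul_assoc t h s, ← hf1 _ (hH' h hh) _ (mul_mem_Kset S ht hk)]
      simp only [Matrix.mul_assoc, cancel_st]
    · funext k
      rw [htr, htr, cancel_ts]
  · intro g _ f _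
    funext k
    change f (s * k * g) = f (s * (k * g))
    rw [Matrix.mul_assoc]

/-- The element `diag(α, σ(α)⁻¹)` of the diagonal torus of `U(1,1)`. -/
def torus (S : USetting E) (α : E) : Mat E := !![α, 0; 0, (S.sig α)⁻¹]

lemma torus_mul_torus_inv (S : USetting E) {α : E} (hα : α ≠ 0) :
    torus S α * torus S α⁻¹ = 1 := by
  have : S.sig α ≠ 0 := (map_ne_zero _).2 hα
  simp [torus, Matrix.one_fin_two, hα, this]

lemma torus_mem_Kset (S : USetting E) {α : E} (hα : S.nu α = 0) : torus S α ∈ Kset S := by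
  have h0 := S.ne_zero_of_nu_eq_zero hα
  have h1 : S.nu (S.sig α) = 0 := by rw [S.nu_sig, hα]
  have h2 := S.ne_zero_of_nu_eq_zero h1
  refine ⟨?_, fun i j => ?_, ?_⟩
  · change ((torus S α).map S.sig)ᵀ * w0 E * torus S α = w0 E
    ext i j
    fin_cases i <;> fin_cases j <;>
      simp [torus, w0, Matrix.mul_apply, Fin.sum_univ_two, S.sig_invol, h0, h2]
  · fin_cases i <;> fin_cases j <;> simp [torus, S.nu_zero, S.nu_inv h1, hα]
  · simp [torus, Matrix.det_fin_two, S.nu_mul, S.nu_inv h1, hα]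

lemma torus_conj_of_ne_zero (S : USetting E) {α : E} (hα : α ≠ 0) (g : Mat E) :
    torus S α⁻¹ * g * torus S α =
      !![g 0 0, (α * S.sig α)⁻¹ * g 0 1; α * S.sig α * g 1 0, g 1 1] := by
  have h : S.sig α ≠ 0 := (map_ne_zero _).2 hα
  ext i j
  fin_cases i <;> fin_cases j <;>
    simp [torus, Matrix.mul_apply, Matrix.vecMul, dotProduct, Fin.sum_univ_two] <;> field_simp

lemma torus_conj_mul (S : USetting E) {α : E} (hα : α ≠ 0) (g h : Mat E) :
    torus S α⁻¹ * (g * h) * torus S α =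
      torus S α⁻¹ * g * torus S α * (torus S α⁻¹ * h * torus S α) := by
  have := torus_mul_torus_inv S hα
  calc torus S α⁻¹ * (g * h) * torus S α
      = torus S α⁻¹ * g * 1 * h * torus S α := by simp only [Matrix.mul_assoc, Matrix.one_mul]
    _ = _ := by rw [← this]; simp only [Matrix.mul_assoc]

lemma torus_conj_smul_one (S : USetting E) {α : E} (hα : α ≠ 0) (z : E) :
    torus S α⁻¹ * (z • (1 : Mat E)) * torus S α = z • (1 : Mat E) := by
  rw [torus_conj_of_ne_zero S hα]
  ext i j
  fin_cases i <;> fin_cases j <;> simp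

lemma torus_conj_mem_Uset (S : USetting E) {α : E} (hα : S.nu α = 0) {m : Mat E}
    (hm : m ∈ Uset S) : torus S α⁻¹ * m * torus S α ∈ Uset S := by
  obtain ⟨b, hb, hb', rfl⟩ := hm
  have hN : S.nu (α * S.sig α) = 0 := by rw [S.nu_mul, S.nu_sig, hα, add_zero]
  refine ⟨(α * S.sig α)⁻¹ * b, ?_, ?_, ?_⟩
  · rw [map_mul, map_inv₀, map_mul, S.sig_invol, hb, mul_comm (S.sig α)]
  · rwa [S.nu_mul, S.nu_inv hN, zero_add]
  · rw [torus_conj_of_ne_zero S (S.ne_zero_of_nu_eq_zero hα)]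
    simp [mul_assoc]

lemma torus_conj_mem_Jgrp (S : USetting E) {α : E} (hα : S.nu α = 0) {d : ℕ} {j : Mat E}
    (hj : j ∈ Jgrp S d) : torus S α⁻¹ * j * torus S α ∈ Jgrp S d := by
  obtain ⟨hK, h00, h01, h11, h10⟩ := hj
  have hN : S.nu (α * S.sig α) = 0 := by rw [S.nu_mul, S.nu_sig, hα, add_zero]
  refine ⟨mul_mem_Kset S (mul_mem_Kset S (torus_mem_Kset S (S.nu_inv hα)) hK)
    (torus_mem_Kset S hα), ?_⟩
  rw [torus_conj_of_ne_zero S (S.ne_zero_of_nu_eq_zero hα)]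
  refine ⟨h00, ?_, h11, ?_⟩
  · change _ ≤ S.nu ((α * S.sig α)⁻¹ * j 0 1)
    rwa [S.nu_mul, S.nu_inv hN, zero_add]
  · change _ ≤ S.nu (α * S.sig α * j 1 0)
    rwa [S.nu_mul, hN, zero_add]

lemma torus_conj_mem_ZUJ (S : USetting E) {α : E} (hα : S.nu α = 0) {d : ℕ} {h : Mat E}
    (hh : h ∈ ZUJ S d) : torus S α⁻¹ * h * torus S α ∈ ZUJ S d := by
  have h0 := S.ne_zero_of_nu_eq_zero hα
  obtain ⟨_, ⟨z, hz, rfl⟩, m, hm, j, hj, rfl⟩ := hh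
  refine ⟨_, ⟨z, hz, rfl⟩, _, torus_conj_mem_Uset S hα hm, _, torus_conj_mem_Jgrp S hα hj, ?_⟩
  rw [torus_conj_mul S h0, torus_conj_mul S h0, torus_conj_smul_one S h0]

lemma one_mem_Kset (S : USetting E) : (1 : Mat E) ∈ Kset S := by
  have := torus_mem_Kset S S.nu_one
  rwa [show torus S 1 = 1 by simp [torus, Matrix.one_fin_two]] at this

lemma one_mem_Jgrp (S : USetting E) (d : ℕ) : (1 : Mat E) ∈ Jgrp S d :=
  ⟨one_mem_Kset S, by simp [S.nu_zero], by simp [S.nu_zero], by simp [S.nu_zero],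
    by simp [S.nu_zero]⟩

lemma one_mem_Uset (S : USetting E) : (1 : Mat E) ∈ Uset S :=
  ⟨0, map_zero _, by simp [S.nu_zero], by simp [Matrix.one_fin_two]⟩

lemma one_mem_Zset (S : USetting E) : (1 : Mat E) ∈ Zset S :=
  ⟨1, by simp [E1set], by simp⟩

lemma isHomOn_apply_mul (S : USetting E) {d : ℕ} {Ψ : Mat E → ℂ} (hΨ : IsHomOn (ZUJ S d) Ψ)
    {z m j : Mat E} (hz : z ∈ Zset S) (hm : m ∈ Uset S) (hj : j ∈ Jgrp S d) :
    Ψ (z * m * j) = Ψ z * Ψ m * Ψ j := by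
  have hzm : z * m ∈ ZUJ S d := ⟨z, hz, m, hm, 1, one_mem_Jgrp S d, by simp⟩
  have hz' : z ∈ ZUJ S d := ⟨z, hz, 1, one_mem_Uset S, 1, one_mem_Jgrp S d, by simp⟩
  have hm' : m ∈ ZUJ S d := ⟨1, one_mem_Zset S, m, hm, 1, one_mem_Jgrp S d, by simp⟩
  have hj' : j ∈ ZUJ S d := ⟨1, one_mem_Zset S, 1, one_mem_Uset S, j, hj, by simp⟩
  rw [hΨ.1 _ hzm _ hj', hΨ.1 _ hz' _ hm']

lemma psiE_eq_of_one_le_nu_sub (S : USetting E) {x y : E} (h : 1 ≤ S.nu (x - y)) :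
    psiE S x = psiE S y := by
  have hfix : ∀ u, S.sig ((u + S.sig u) / 2) = (u + S.sig u) / 2 := fun u => by
    rw [map_div₀, map_add, S.sig_invol, map_ofNat, add_comm]
  have hsplit : (x + S.sig x) / 2 = (y + S.sig y) / 2 + (x - y + S.sig (x - y)) / 2 := by
    rw [map_sub]
    ring
  unfold psiE
  rw [hsplit, S.psi'_mul _ _ (hfix _) (hfix _), S.psi'_triv ((x - y + S.sig (x - y)) / 2) (hfix _),
    mul_one]
  rw [div_eq_mul_inv, S.nu_mul, S.nu_inv S.nu_two, add_zero]
  exact S.le_nu_add h (by rwa [S.nu_sig])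

lemma PsiC_Xdelta (S : USetting E) (δ : E) (g : Mat E) :
    PsiC S (Xdelta S δ) g = psiE S (δ * S.sqeps * g 1 0) := by
  simp [PsiC, Xdelta, Matrix.trace_fin_two, Matrix.vecMul, dotProduct]

lemma PsiC_Xdelta_torus_conj (S : USetting E) {a α : E} (hα : α ≠ 0) {d : ℕ}
    (h : (d : WithTop ℤ) ≤ S.nu (a - α * S.sig α)) {j : Mat E} (hj : j ∈ Jgrp S d) :
    PsiC S (Xdelta S (S.pi ^ (-(d : ℤ)))) (torus S α⁻¹ * j * torus S α) =
      PsiC S (Xdelta S (a * S.pi ^ (-(d : ℤ)))) j := by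
  have h10 := hj.2.2.2.2
  rw [PsiC_Xdelta, PsiC_Xdelta, torus_conj_of_ne_zero S hα]
  refine (psiE_eq_of_one_le_nu_sub S ?_).symm
  have : a * S.pi ^ (-(d : ℤ)) * S.sqeps * j 1 0 -
      S.pi ^ (-(d : ℤ)) * S.sqeps * (α * S.sig α * j 1 0) =
      S.pi ^ (-(d : ℤ)) * S.sqeps * ((a - α * S.sig α) * j 1 0) := by ring
  change 1 ≤ S.nu (_ - S.pi ^ (-(d : ℤ)) * S.sqeps * (α * S.sig α * j 1 0))
  rw [this, S.nu_mul, S.nu_mul, S.nu_mul, S.nu_sqeps, add_zero, S.nu_pi_zpow_neg]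
  refine le_trans ?_ (add_le_add le_rfl (add_le_add h h10))
  change ((1 : ℤ) : WithTop ℤ) ≤ (((-(d : ℤ)) + ((d : ℤ) + ((d / 2 + 1 : ℕ) : ℤ)) : ℤ) : WithTop ℤ)
  rw [WithTop.coe_le_coe]
  omega

/-- the induced representations `S_d(X_{ϖ^{−d}}, θ)` and
`S_d(X_{aϖ^{−d}}, θ)`, for `a ∈ O_F^×`, are isomorphic as `K`-representations. -/
theorem stmt17 (S : USetting E) (d : ℕ) (hd : 1 ≤ d) (a : E)
    (haf : S.sig a = a) (hau : S.nu a = 0)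
    (θ : E → ℂ) (hθhom : IsE1Hom S θ)
    (hθtriv : ∀ z ∈ E1set S, z • (1 : Mat E) ∈ Jgrp S d → θ z = 1)
    (Ψ₁ Ψₐ : Mat E → ℂ)
    (hΨ₁hom : IsHomOn (ZUJ S d) Ψ₁)
    (hΨ₁Z : ∀ z ∈ E1set S, Ψ₁ (z • (1 : Mat E)) = θ z)
    (hΨ₁U : ∀ m ∈ Uset S, Ψ₁ m = 1)
    (hΨ₁J : ∀ j ∈ Jgrp S d, Ψ₁ j = PsiC S (Xdelta S (S.pi ^ (-(d : ℤ)))) j)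
    (hΨₐhom : IsHomOn (ZUJ S d) Ψₐ)
    (hΨₐZ : ∀ z ∈ E1set S, Ψₐ (z • (1 : Mat E)) = θ z)
    (hΨₐU : ∀ m ∈ Uset S, Ψₐ m = 1)
    (hΨₐJ : ∀ j ∈ Jgrp S d, Ψₐ j = PsiC S (Xdelta S (a * S.pi ^ (-(d : ℤ)))) j) :
    RepIso S (IndSp S (ZUJ S d) Ψ₁) (IndSp S (ZUJ S d) Ψₐ) := by
  obtain ⟨α, hα⟩ := S.exists_norm_approx haf hau d hd
  have hα0 : S.nu α = 0 := S.nu_eq_zero_of_norm_approx hau hd hα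
  have hne := S.ne_zero_of_nu_eq_zero hα0
  have hinv : S.nu α⁻¹ = 0 := S.nu_inv hα0
  refine repIso_indSp_of_conj S (torus_mem_Kset S hinv) (torus_mem_Kset S hα0) ?_
    (torus_mul_torus_inv S hne) (fun h hh => torus_conj_mem_ZUJ S hα0 hh) (fun h hh => ?_) ?_
  · simpa using torus_mul_torus_inv S (inv_ne_zero hne)
  · simpa using torus_conj_mem_ZUJ S hinv hh
  · rintro _ ⟨_, ⟨z, hz, rfl⟩, m, hm, j, hj, rfl⟩
    have hm' := torus_conj_mem_Uset S hα0 hm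
    have hj' := torus_conj_mem_Jgrp S hα0 hj
    rw [torus_conj_mul S hne, torus_conj_mul S hne, torus_conj_smul_one S hne,
      isHomOn_apply_mul S hΨ₁hom ⟨z, hz, rfl⟩ hm' hj',
      isHomOn_apply_mul S hΨₐhom ⟨z, hz, rfl⟩ hm hj,
      hΨ₁Z z hz, hΨₐZ z hz, hΨ₁U _ hm', hΨₐU m hm, hΨ₁J _ hj', hΨₐJ j hj,
      PsiC_Xdelta_torus_conj S hne hα hj]
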